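/- Let τ and τ' be permutations of the vectors of F^r and F^{r'} respectively, each fixing the all-zero vector. If S_τ and S_{τ'} are coordinate transitive codes, then S_{τ|τ'} is a coordinate transitive code of length 2^{r+r'+1}. If, moreover, τ and τ' are induced by automorphisms of regular subgroups of GA(r,2) and GA(r',2) respectively, then S_{τ|τ'} is neighbor transitive. -/

import Mathlib

open Finset

/-- `V r` is the vector space `F^r` over `F = GF(2)`. -/
abbrev V (r : ℕ) : Type := Fin r → ZMod 2

/-- The point set of `SQS_τ` (and the coordinate set of codes of length `2^{r+1}`):
left-half points `({a},∅)` are `Sum.inl a`, right-half points `(∅,{a})` are `Sum.inr a`. -/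
abbrev Pt (r : ℕ) : Type := V r ⊕ V r

/-- Action of a coordinate permutation `π` on a word: `π(y)_i = y_{π⁻¹(i)}`. -/
def permAct {ι : Type} (π : Equiv.Perm ι) (y : ι → ZMod 2) : ι → ZMod 2 :=
  fun i => y (π.symm i)

/-- The extended Hamming code of length `2^r`, with coordinates indexed by the vectors
of `F^r`: all even weight words whose support sums to zero. -/
def extHamming (r : ℕ) : Set (V r → ZMod 2) :=
  {x | ∑ a : V r, x a • a = 0 ∧ ∑ a : V r, x a = 0}

/-- `e_a` : the weight-one word with support `{a}`. -/
def unitVec {r : ℕ} (a : V r) : V r → ZMod 2 :=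
  fun b => if b = a then 1 else 0

/-- The code `S_τ = ⋃_{a ∈ F^r} (H + e_a + e_0) × (H + e_{τ(a)} + e_0)` of length `2^{r+1}`. -/
def Scode {r : ℕ} (τ : Equiv.Perm (V r)) : Set (Pt r → ZMod 2) :=
  ⋃ a : V r, {z | ∃ h₁ ∈ extHamming r, ∃ h₂ ∈ extHamming r,
    z = Sum.elim (h₁ + unitVec a + unitVec 0) (h₂ + unitVec (τ a) + unitVec 0)}

/-- `Q_0` : quadruples `({a,b,c,d},∅)`, `a,b,c,d` pairwise distinct, `a+b+c+d=0`. -/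
def Q0 (r : ℕ) : Set (Finset (Pt r)) :=
  {q | ∃ a b c d : V r, a ≠ b ∧ a ≠ c ∧ a ≠ d ∧ b ≠ c ∧ b ≠ d ∧ c ≠ d ∧
    a + b + c + d = 0 ∧ q = {Sum.inl a, Sum.inl b, Sum.inl c, Sum.inl d}}

/-- `Q_1` : quadruples `(∅,{a,b,c,d})`, `a,b,c,d` pairwise distinct, `a+b+c+d=0`. -/
def Q1 (r : ℕ) : Set (Finset (Pt r)) :=
  {q | ∃ a b c d : V r, a ≠ b ∧ a ≠ c ∧ a ≠ d ∧ b ≠ c ∧ b ≠ d ∧ c ≠ d ∧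
    a + b + c + d = 0 ∧ q = {Sum.inr a, Sum.inr b, Sum.inr c, Sum.inr d}}

/-- `Q_τ` : quadruples `({a,c},{b,d})` with `τ(a+c) = b+d ≠ 0`. -/
def Qt {r : ℕ} (τ : Equiv.Perm (V r)) : Set (Finset (Pt r)) :=
  {q | ∃ a b c d : V r, τ (a + c) = b + d ∧ b + d ≠ 0 ∧
    q = {Sum.inl a, Sum.inl c, Sum.inr b, Sum.inr d}}

/-- The Steiner quadruple system `SQS_τ = Q_0 ∪ Q_1 ∪ Q_τ`. -/
def SQS {r : ℕ} (τ : Equiv.Perm (V r)) : Set (Finset (Pt r)) :=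
  Q0 r ∪ Q1 r ∪ Qt τ

/-- Action of a point bijection on a set system. -/
def qAct {α β : Type} [DecidableEq β] (π : α ≃ β) (Q : Set (Finset α)) : Set (Finset β) :=
  (fun q => q.image π) '' Q

/-- All quadruples of the system `Q` containing both points `p` and `p'`. -/
def quadsThrough {r : ℕ} (Q : Set (Finset (Pt r))) (p p' : Pt r) : Set (Finset (Pt r)) :=
  {q ∈ Q | p ∈ q ∧ p' ∈ q}

/-- The affine permutation `σ_{a,A} : b ↦ a + A b` of `F^r`, where `A ∈ GL(r,2)`. -/
def affEquiv {r : ℕ} (a : V r) (A : V r ≃ₗ[ZMod 2] V r) : Equiv.Perm (V r) :=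
  A.toEquiv.trans (Equiv.addLeft a)

/-- The permutation `ξ` swapping `({a},∅)` with `(∅,{a})` for every `a`. -/
def xi (r : ℕ) : Equiv.Perm (Pt r) := Equiv.sumComm (V r) (V r)

/-- Point transitivity of the Steiner quadruple system `SQS_τ`. -/
def SQSPointTransitive {r : ℕ} (τ : Equiv.Perm (V r)) : Prop :=
  ∀ p p' : Pt r, ∃ π : Equiv.Perm (Pt r), qAct π (SQS τ) = SQS τ ∧ π p = p'

/-- A code is transitive if (a subgroup of) its automorphism group acts transitively
on its codewords: any codeword is mapped to any other by an automorphism `y ↦ x + π(y)`. -/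
def IsTransitiveCode {ι : Type} (C : Set (ι → ZMod 2)) : Prop :=
  ∀ c ∈ C, ∀ c' ∈ C, ∃ (x : ι → ZMod 2) (π : Equiv.Perm ι),
    (fun y => x + permAct π y) '' C = C ∧ x + permAct π c = c'

/-- A code is coordinate transitive if `PAut(C)` acts transitively on coordinates. -/
def CoordTransitive {ι : Type} (C : Set (ι → ZMod 2)) : Prop :=
  ∀ i j : ι, ∃ π : Equiv.Perm ι, permAct π '' C = C ∧ π i = j

/-- `C_1` : the words at Hamming distance exactly 1 from the code `C`. -/
def codeNbrs {ι : Type} [Fintype ι] (C : Set (ι → ZMod 2)) : Set (ι → ZMod 2) :=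
  {y | y ∉ C ∧ ∃ c ∈ C, hammingDist y c = 1}

/-- A code is neighbor transitive if `Aut(C)` acts transitively both on `C` and on `C_1`. -/
def NeighborTransitive {ι : Type} [Fintype ι] (C : Set (ι → ZMod 2)) : Prop :=
  IsTransitiveCode C ∧
  ∀ y ∈ codeNbrs C, ∀ y' ∈ codeNbrs C, ∃ (x : ι → ZMod 2) (π : Equiv.Perm ι),
    (fun w => x + permAct π w) '' C = C ∧ x + permAct π y = y'

/-- An extended perfect code: minimum distance 4 and `2^n/(2n)` codewords. -/
def IsExtPerfect {ι : Type} [Fintype ι] (C : Set (ι → ZMod 2)) : Prop :=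
  (∀ x ∈ C, ∀ y ∈ C, x ≠ y → 4 ≤ hammingDist x y) ∧
  (∃ x ∈ C, ∃ y ∈ C, hammingDist x y = 4) ∧
  Nat.card C * (2 * Fintype.card ι) = 2 ^ Fintype.card ι

/-- The (extended) Mollard code `M(C,D)` with function `φ`. -/
def mollard {t m : ℕ} (C : Set (Fin t → ZMod 2)) (D : Set (Fin m → ZMod 2))
    (φ : (Fin t → ZMod 2) → (Fin m → ZMod 2)) : Set (Fin t × Fin m → ZMod 2) :=
  {z | (fun i => ∑ j, z (i, j)) ∈ C ∧
       ∃ d ∈ D, (fun j => ∑ i, z (i, j)) = φ (fun i => ∑ j, z (i, j)) + d}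

/-- Isomorphism of codes over possibly different coordinate sets:
`D = x + π(C)` for a coordinate bijection `π` and a vector `x`. -/
def CodeIso {ι κ : Type} (C : Set (ι → ZMod 2)) (D : Set (κ → ZMod 2)) : Prop :=
  ∃ (e : ι ≃ κ) (x : κ → ZMod 2), (fun z => x + fun k => z (e.symm k)) '' C = D

/-- The rank of a code: the dimension of its linear span. -/
noncomputable def codeRank {ι : Type} (C : Set (ι → ZMod 2)) : ℕ :=
  Module.finrank (ZMod 2) ↥(Submodule.span (ZMod 2) C)

/-- The kernel of a code: `{x : x + C = C}`. -/
def codeKernel {ι : Type} (C : Set (ι → ZMod 2)) : Set (ι → ZMod 2) :=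
  {x | (fun y => x + y) '' C = C}

/-- The dimension of the kernel of a code. -/
noncomputable def kernelDim {ι : Type} (C : Set (ι → ZMod 2)) : ℕ :=
  codeRank (codeKernel C)

/-- A permutation of `F^r` is affine if it is of the form `b ↦ a + A b`, `A ∈ GL(r,2)`. -/
def IsAffinePerm {r : ℕ} (g : Equiv.Perm (V r)) : Prop :=
  ∃ (a : V r) (A : V r ≃ₗ[ZMod 2] V r), ∀ x, g x = a + A x

/-- A regular subgroup of `GA(r,2)`: a subgroup consisting of affine permutations that
acts sharply transitively on `F^r`. -/
def IsRegularAffineSubgroup {r : ℕ} (G : Subgroup (Equiv.Perm (V r))) : Prop :=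
  (∀ g ∈ G, IsAffinePerm g) ∧ ∀ u v : V r, ∃! g : G, (g : Equiv.Perm (V r)) u = v

/-- `τ` is induced by an automorphism `T` of a regular subgroup `G ≤ GA(r,2)`:
`T(g_a) = g_{τ(a)}`, i.e. `τ(g(0)) = (T g)(0)` for every `g ∈ G`. -/
def InducedByRegularAut {r : ℕ} (τ : Equiv.Perm (V r)) : Prop :=
  ∃ G : Subgroup (Equiv.Perm (V r)), IsRegularAffineSubgroup G ∧
    ∃ T : G ≃* G, ∀ g : G, τ ((g : Equiv.Perm (V r)) 0) = (T g : Equiv.Perm (V r)) 0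

/-- The identification `F^{r+r'} ≃ F^r × F^{r'}`, `x|y ↦ (x,y)`. -/
def splitEquiv (r r' : ℕ) : V (r + r') ≃ V r × V r' :=
  (finSumFinEquiv.symm.arrowCongr (Equiv.refl (ZMod 2))).trans
    (Equiv.sumArrowEquivProdArrow _ _ _)

/-- The concatenation `τ|τ'` of permutations: `(τ|τ')(x|y) = τ(x)|τ'(y)`. -/
def concatPerm {r r' : ℕ} (τ : Equiv.Perm (V r)) (τ' : Equiv.Perm (V r')) :
    Equiv.Perm (V (r + r')) :=
  (splitEquiv r r').trans ((τ.prodCongr τ').trans (splitEquiv r r').symm)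


/-- The syndrome map. -/
def syn {r : ℕ} (x : V r → ZMod 2) : V r := ∑ a : V r, x a • a

/-- The parity map. -/
def par {r : ℕ} (x : V r → ZMod 2) : ZMod 2 := ∑ a : V r, x a

theorem syn_add {r : ℕ} (x y : V r → ZMod 2) : syn (x + y) = syn x + syn y := by
  simp [syn, add_smul, Finset.sum_add_distrib]

theorem par_add {r : ℕ} (x y : V r → ZMod 2) : par (x + y) = par x + par y := by
  simp [par, Finset.sum_add_distrib]

theorem syn_zero {r : ℕ} : syn (0 : V r → ZMod 2) = 0 := by simp [syn]

theorem par_zero {r : ℕ} : par (0 : V r → ZMod 2) = 0 := by simp [par]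

theorem syn_single {r : ℕ} (a : V r) : syn (Pi.single a 1) = a := by
  unfold syn
  rw [Finset.sum_eq_single a]
  · simp
  · intro b _ hb; simp [Pi.single_apply, hb]
  · simp

theorem par_single {r : ℕ} (a : V r) : par (Pi.single a 1 : V r → ZMod 2) = 1 := by
  simp [par]

theorem unitVec_eq {r : ℕ} (a : V r) : unitVec a = Pi.single a 1 := by
  funext b; simp [unitVec, Pi.single_apply]

theorem v_add_self {ι : Type} (a : ι → ZMod 2) : a + a = 0 := by
  funext i; exact CharTwo.add_self_eq_zero _

theorem v_add_eq_zero {ι : Type} {a b : ι → ZMod 2} : a + b = 0 ↔ a = b := by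
  constructor
  · intro h
    have : a + b + b = b := by rw [h, zero_add]
    rwa [add_assoc, v_add_self, add_zero] at this
  · rintro rfl; exact v_add_self _

theorem v_cancel {ι : Type} (a b : ι → ZMod 2) : a + (a + b) = b := by
  rw [← add_assoc, v_add_self, zero_add]

/-- left half -/
def lf {r : ℕ} (z : Pt r → ZMod 2) : V r → ZMod 2 := fun a => z (Sum.inl a)
/-- right half -/
def rt {r : ℕ} (z : Pt r → ZMod 2) : V r → ZMod 2 := fun a => z (Sum.inr a)

theorem lf_add {r : ℕ} (z w : Pt r → ZMod 2) : lf (z + w) = lf z + lf w := rfl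
theorem rt_add {r : ℕ} (z w : Pt r → ZMod 2) : rt (z + w) = rt z + rt w := rfl
theorem lf_zero {r : ℕ} : lf (0 : Pt r → ZMod 2) = 0 := rfl
theorem rt_zero {r : ℕ} : rt (0 : Pt r → ZMod 2) = 0 := rfl

theorem lf_inl {r : ℕ} (a : V r) : lf (Pi.single (Sum.inl a) 1) = Pi.single a 1 := by
  funext b; simp [lf, Pi.single_apply]
theorem lf_inr {r : ℕ} (a : V r) : lf (Pi.single (Sum.inr a) 1) = 0 := by
  funext b; simp [lf, Pi.single_apply]
theorem rt_inr {r : ℕ} (a : V r) : rt (Pi.single (Sum.inr a) 1) = Pi.single a 1 := by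
  funext b; simp [rt, Pi.single_apply]
theorem rt_inl {r : ℕ} (a : V r) : rt (Pi.single (Sum.inl a) 1) = 0 := by
  funext b; simp [rt, Pi.single_apply]

theorem mem_extHamming {r : ℕ} (x : V r → ZMod 2) :
    x ∈ extHamming r ↔ syn x = 0 ∧ par x = 0 := Iff.rfl

theorem mem_Scode {r : ℕ} (τ : Equiv.Perm (V r)) (z : Pt r → ZMod 2) :
    z ∈ Scode τ ↔ par (lf z) = 0 ∧ par (rt z) = 0 ∧ τ (syn (lf z)) = syn (rt z) := by
  unfold Scode
  simp only [Set.mem_iUnion, Set.mem_setOf_eq, mem_extHamming, unitVec_eq]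
  constructor
  · rintro ⟨a, h₁, ⟨hs1, hp1⟩, h₂, ⟨hs2, hp2⟩, rfl⟩
    have e1 : lf (Sum.elim (h₁ + Pi.single a 1 + Pi.single 0 1)
        (h₂ + Pi.single (τ a) 1 + Pi.single 0 1)) = h₁ + Pi.single a 1 + Pi.single 0 1 := rfl
    have e2 : rt (Sum.elim (h₁ + Pi.single a 1 + Pi.single 0 1)
        (h₂ + Pi.single (τ a) 1 + Pi.single 0 1)) = h₂ + Pi.single (τ a) 1 + Pi.single 0 1 := rfl
    rw [e1, e2]
    simp only [syn_add, par_add, syn_single, par_single, hs1, hs2, hp1, hp2]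
    refine ⟨by decide, by decide, by simp⟩
  · rintro ⟨h1, h2, h3⟩
    refine ⟨syn (lf z), lf z + (Pi.single (syn (lf z)) 1 + Pi.single 0 1), ?_,
      rt z + (Pi.single (syn (rt z)) 1 + Pi.single 0 1), ?_, ?_⟩
    · simp only [syn_add, par_add, syn_single, par_single, h1]
      exact ⟨by rw [add_zero, v_add_self], by decide⟩
    · simp only [syn_add, par_add, syn_single, par_single, h2]
      exact ⟨by rw [add_zero, v_add_self], by decide⟩
    · rw [h3, add_assoc (lf z + _), add_assoc (rt z + _), add_assoc (lf z), add_assoc (rt z),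
        v_add_self, v_add_self, add_zero, add_zero]
      funext i; cases i <;> rfl

theorem permAct_add {ι : Type} (π : Equiv.Perm ι) (y z : ι → ZMod 2) :
    permAct π (y + z) = permAct π y + permAct π z := rfl

theorem permAct_zero {ι : Type} (π : Equiv.Perm ι) :
    permAct π (0 : ι → ZMod 2) = 0 := rfl

theorem permAct_single {ι : Type} [DecidableEq ι] (π : Equiv.Perm ι) (i : ι) :
    permAct π (Pi.single i 1) = Pi.single (π i) 1 := by
  funext j
  simp only [permAct, Pi.single_apply, Equiv.symm_apply_eq]

theorem permAct_injective {ι : Type} (π : Equiv.Perm ι) :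
    Function.Injective (permAct π) := by
  intro y z h
  funext i
  have := congrFun h (π i)
  simpa [permAct] using this

theorem image_eq_of_mapsTo {ι : Type} [Finite ι] {C : Set (ι → ZMod 2)}
    {x : ι → ZMod 2} {π : Equiv.Perm ι}
    (h : ∀ z ∈ C, x + permAct π z ∈ C) : (fun y => x + permAct π y) '' C = C := by
  have inj : Function.Injective (fun y => x + permAct π y) := by
    intro y z h
    exact permAct_injective π (add_left_cancel h)
  apply Set.eq_of_subset_of_ncard_le
  · rintro _ ⟨z, hz, rfl⟩; exact h z hz
  · rw [Set.ncard_image_of_injective _ inj]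
  · exact Set.toFinite _

theorem image_eq_of_mapsTo' {ι : Type} [Finite ι] {C : Set (ι → ZMod 2)}
    {π : Equiv.Perm ι}
    (h : ∀ z ∈ C, permAct π z ∈ C) : permAct π '' C = C := by
  have := image_eq_of_mapsTo (C := C) (x := 0) (π := π) (by simpa using h)
  simpa using this

/-! ### Characterization of the swap property -/

/-- `τ B τ` is additive for an additive permutation `B`. -/
def Swp {r : ℕ} (τ : Equiv.Perm (V r)) : Prop :=
  ∃ B : Equiv.Perm (V r), (∀ a b, B (a + b) = B a + B b) ∧
    ∀ a b, τ (B (τ (a + b))) = τ (B (τ a)) + τ (B (τ b))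

theorem map_syn {r : ℕ} (A : Equiv.Perm (V r)) (hA : ∀ a b, A (a + b) = A a + A b)
    (x : V r → ZMod 2) : syn (fun b => x (A.symm b)) = A (syn x) := by
  let A' : V r →+ V r := AddMonoidHom.mk' A hA
  have h : ∀ y, A y = A' y := fun _ => rfl
  unfold syn
  rw [h, map_sum, ← Equiv.sum_comp A]
  apply Finset.sum_congr rfl
  intro a _
  beta_reduce
  rw [Equiv.symm_apply_apply]
  have : ∀ c : ZMod 2, c • A a = A' (c • a) := by
    intro c
    fin_cases c
    · change (0 : ZMod 2) • A a = A' ((0 : ZMod 2) • a); simp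
    · change (1 : ZMod 2) • A a = A' ((1 : ZMod 2) • a); simp [h]
  exact this _

theorem map_par {r : ℕ} (A : Equiv.Perm (V r))
    (x : V r → ZMod 2) : par (fun b => x (A.symm b)) = par x := by
  unfold par
  exact Equiv.sum_comp A.symm x

theorem syn_shift {r : ℕ} (u : V r) (x : V r → ZMod 2) (hx : par x = 0) :
    syn (fun b => x ((Equiv.addRight u).symm b)) = syn x := by
  unfold syn
  rw [← Equiv.sum_comp (Equiv.addRight u)]
  simp only [Equiv.symm_apply_apply]
  simp only [Equiv.coe_addRight, smul_add, Finset.sum_add_distrib]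
  rw [← Finset.sum_smul]
  unfold par at hx
  rw [hx]; simp

theorem shift_mem {r : ℕ} (τ : Equiv.Perm (V r)) (u v : V r) :
    permAct (Equiv.sumCongr (Equiv.addRight u) (Equiv.addRight v)) '' Scode τ = Scode τ := by
  apply image_eq_of_mapsTo'
  intro z hz
  rw [mem_Scode] at hz ⊢
  obtain ⟨h1, h2, h3⟩ := hz
  have e1 : lf (permAct (Equiv.sumCongr (Equiv.addRight u) (Equiv.addRight v)) z)
    = fun b => lf z ((Equiv.addRight u).symm b) := rfl
  have e2 : rt (permAct (Equiv.sumCongr (Equiv.addRight u) (Equiv.addRight v)) z)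
    = fun b => rt z ((Equiv.addRight v).symm b) := rfl
  rw [e1, e2, map_par, map_par, syn_shift _ _ h1, syn_shift _ _ h2]
  exact ⟨h1, h2, h3⟩

/-- the swapping permutation -/
def swapPerm {r : ℕ} (A B : Equiv.Perm (V r)) : Equiv.Perm (Pt r) :=
  (Equiv.sumCongr A B).trans (Equiv.sumComm _ _)

theorem swap_mem {r : ℕ} (τ A B : Equiv.Perm (V r))
    (hB : ∀ a b, B (a + b) = B a + B b) (hA : ∀ a b, A (a + b) = A a + A b)
    (h : ∀ a, τ (B (τ a)) = A a) :
    permAct (swapPerm A B) '' Scode τ = Scode τ := by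
  apply image_eq_of_mapsTo'
  intro z hz
  rw [mem_Scode] at hz ⊢
  obtain ⟨h1, h2, h3⟩ := hz
  have e1 : lf (permAct (swapPerm A B) z) = fun b => rt z (B.symm b) := rfl
  have e2 : rt (permAct (swapPerm A B) z) = fun b => lf z (A.symm b) := rfl
  rw [e1, e2, map_par, map_par, map_syn _ hB, map_syn _ hA, ← h3, h]
  exact ⟨h2, h1, rfl⟩

theorem permAct_trans {ι : Type} (π ρ : Equiv.Perm ι) (y : ι → ZMod 2) :
    permAct (π.trans ρ) y = permAct ρ (permAct π y) := rfl

theorem image_trans {ι : Type} {C : Set (ι → ZMod 2)} {π ρ : Equiv.Perm ι}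
    (h : permAct π '' C = C) (h' : permAct ρ '' C = C) :
    permAct (π.trans ρ) '' C = C := by
  have : permAct (π.trans ρ) = permAct ρ ∘ permAct π := rfl
  rw [this, Set.image_comp, h, h']

theorem coord_of_swp {r : ℕ} (τ : Equiv.Perm (V r)) (h : Swp τ) :
    CoordTransitive (Scode τ) := by
  obtain ⟨B, hB, hA⟩ := h
  have hs := swap_mem τ (τ.trans (B.trans τ)) B hB hA (fun _ => rfl)
  set A := τ.trans (B.trans τ)
  rintro (a | a) (b | b)
  · refine ⟨_, shift_mem τ (-a + b) 0, ?_⟩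
    simp
  · refine ⟨_, image_trans hs (shift_mem τ 0 (-(A a) + b)), ?_⟩
    simp [swapPerm]
  · refine ⟨_, image_trans hs (shift_mem τ (-(B a) + b) 0), ?_⟩
    simp [swapPerm]
  · refine ⟨_, shift_mem τ 0 (-a + b), ?_⟩
    simp

/-- The word with the four given ones. -/
def quad {r : ℕ} (i j k l : Pt r) : Pt r → ZMod 2 :=
  Pi.single i 1 + Pi.single j 1 + Pi.single k 1 + Pi.single l 1

theorem permAct_quad {r : ℕ} (π : Equiv.Perm (Pt r)) (i j k l : Pt r) :
    permAct π (quad i j k l) = quad (π i) (π j) (π k) (π l) := by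
  simp only [quad, permAct_add, permAct_single]

/-- kernel membership -/
def Ker {r : ℕ} (τ : Equiv.Perm (V r)) (z : Pt r → ZMod 2) : Prop :=
  ∀ c ∈ Scode τ, c + z ∈ Scode τ

theorem ker_perm {r : ℕ} {τ : Equiv.Perm (V r)} {π : Equiv.Perm (Pt r)}
    (hπ : permAct π '' Scode τ = Scode τ) {z : Pt r → ZMod 2} (hz : Ker τ z) :
    Ker τ (permAct π z) := by
  intro c hc
  rw [← hπ] at hc
  obtain ⟨d, hd, rfl⟩ := hc
  rw [← permAct_add, ← hπ]
  exact ⟨_, hz d hd, rfl⟩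

theorem zero_mem_S {r : ℕ} {τ : Equiv.Perm (V r)} (h0 : τ 0 = 0) :
    (0 : Pt r → ZMod 2) ∈ Scode τ := by
  rw [mem_Scode]
  simp [lf_zero, rt_zero, par_zero, syn_zero, h0]

theorem ker_mem {r : ℕ} {τ : Equiv.Perm (V r)} (h0 : τ 0 = 0) {z : Pt r → ZMod 2}
    (hz : Ker τ z) : z ∈ Scode τ := by
  simpa using hz 0 (zero_mem_S h0)

/-- `Side b` embeds into the left or the right half. -/
def side {r : ℕ} (b : Bool) (a : V r) : Pt r := if b then Sum.inl a else Sum.inr a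

theorem one4 : (1 : ZMod 2) + 1 + 1 + 1 = 0 := by decide

theorem ker_quad {r : ℕ} (τ : Equiv.Perm (V r)) (s : Bool) (a b c : V r) :
    Ker τ (quad (side s a) (side s b) (side s c) (side s (a + b + c))) := by
  intro z hz
  rw [mem_Scode] at hz ⊢
  obtain ⟨h1, h2, h3⟩ := hz
  cases s <;>
  simp only [side, quad, lf_add, rt_add, lf_inl, lf_inr, rt_inl, rt_inr, par_add, syn_add,
    par_single, syn_single, par_zero, syn_zero, h1, h2, h3, one4, add_zero, zero_add,
    v_add_self, if_true, if_false, Bool.false_eq_true] <;> exact ⟨trivial, trivial, trivial⟩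

/-- linear structures of `τ` -/
def LS {r : ℕ} (τ : Equiv.Perm (V r)) (u : V r) : Prop := ∀ s, τ (s + u) = τ s + τ u

theorem exists_word {r : ℕ} (τ : Equiv.Perm (V r)) (s : V r) :
    quad (Sum.inl s) (Sum.inl 0) (Sum.inr (τ s)) (Sum.inr 0) ∈ Scode τ := by
  rw [mem_Scode]
  simp only [quad, lf_add, rt_add, lf_inl, lf_inr, rt_inl, rt_inr, par_add, syn_add,
    par_single, syn_single, par_zero, syn_zero, add_zero, zero_add]
  exact ⟨by decide, by decide, trivial⟩

theorem LS_of_ker {r : ℕ} {τ : Equiv.Perm (V r)} (h0 : τ 0 = 0) {a b c d : V r}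
    (h : Ker τ (quad (Sum.inl a) (Sum.inl b) (Sum.inr c) (Sum.inr d))) : LS τ (a + b) := by
  have key : ∀ s, τ (s + (a + b)) = τ s + (c + d) := by
    intro s
    have := h _ (exists_word τ s)
    rw [mem_Scode] at this
    have := this.2.2
    simpa only [quad, lf_add, rt_add, lf_inl, lf_inr, rt_inl, rt_inr, syn_add,
      syn_single, syn_zero, add_zero, zero_add] using this
  intro s
  have k0 := key 0
  rw [zero_add, h0, zero_add] at k0
  rw [key, k0]

theorem quad_par {r : ℕ} {τ : Equiv.Perm (V r)} {i j k l : Pt r}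
    (h : quad i j k l ∈ Scode τ) (hi : i.isLeft) (hj : j.isLeft) (hk : k.isRight) :
    l.isRight := by
  rw [mem_Scode] at h
  have := h.1
  rcases i with i | i <;> rcases j with j | j <;> rcases k with k | k <;> rcases l with l | l <;>
    simp_all [quad, lf_add, lf_inl, lf_inr, par_add, par_single, par_zero]
  exact absurd h.1 (by decide)

theorem LS_of_mixed {r : ℕ} {τ : Equiv.Perm (V r)} (h0 : τ 0 = 0) {π : Equiv.Perm (Pt r)}
    (hπ : permAct π '' Scode τ = Scode τ) (s : Bool) {x y c : V r}
    {p q t : V r} (hx : π (side s x) = Sum.inl p) (hy : π (side s y) = Sum.inl q)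
    (hc : π (side s c) = Sum.inr t) : LS τ (p + q) := by
  have hk := ker_perm hπ (ker_quad τ s x y c)
  rw [permAct_quad, hx, hy, hc] at hk
  have hr := quad_par (ker_mem h0 hk) rfl rfl rfl
  obtain ⟨d, hd⟩ := Sum.isRight_iff.mp hr
  rw [hd] at hk
  exact LS_of_ker h0 hk

theorem swp_of_linear {r : ℕ} {τ : Equiv.Perm (V r)}
    (h : ∀ a b, τ (a + b) = τ a + τ b) : Swp τ := by
  refine ⟨τ.symm, ?_, ?_⟩
  · intro a b
    apply τ.injective
    rw [h]; simp
  · intro a b; simp [h]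

theorem linear_of_LS {r : ℕ} {τ : Equiv.Perm (V r)}
    (h : ∀ x y, LS τ x ∨ LS τ y ∨ LS τ (x + y)) (a b : V r) : τ (a + b) = τ a + τ b := by
  rcases h a b with h | h | h
  · rw [add_comm, h, add_comm]
  · exact h a
  · have := h b
    rw [add_comm a b, v_cancel] at this
    rw [add_comm a b, this, add_right_comm, v_add_self, zero_add]

theorem swp_of_exchange {r : ℕ} {τ : Equiv.Perm (V r)} (h0 : τ 0 = 0) {π : Equiv.Perm (Pt r)}
    (hπ : permAct π '' Scode τ = Scode τ) (f g : V r → V r)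
    (hf : ∀ a, π (Sum.inl a) = Sum.inr (f a)) (hg : ∀ a, π (Sum.inr a) = Sum.inl (g a)) :
    Swp τ := by
  have hf_add : ∀ a b, f (a + b) + f 0 = (f a + f 0) + (f b + f 0) := by
    intro a b
    have hk := ker_mem h0 (ker_perm hπ (ker_quad τ true a b 0))
    simp only [side, if_true, permAct_quad, hf, mem_Scode] at hk
    have := hk.2.2
    simp only [quad, lf_add, rt_add, lf_inl, lf_inr, rt_inl, rt_inr, syn_add,
      syn_single, syn_zero, add_zero, h0] at this
    have h2 := v_add_eq_zero.mp this.symm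
    rw [← h2, add_assoc (f a + f b), v_add_self, add_zero, add_add_add_comm, v_add_self, add_zero]
  have hg_add : ∀ a b, g (a + b) + g 0 = (g a + g 0) + (g b + g 0) := by
    intro a b
    have hk := ker_mem h0 (ker_perm hπ (ker_quad τ false a b 0))
    simp only [side, Bool.false_eq_true, if_false, permAct_quad, hg, mem_Scode] at hk
    have := hk.2.2
    simp only [quad, lf_add, rt_add, lf_inl, lf_inr, rt_inl, rt_inr, syn_add,
      syn_single, syn_zero, add_zero] at this
    have this := τ.injective (this.trans h0.symm)
    have h2 := v_add_eq_zero.mp this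
    rw [← h2, add_assoc (g a + g b), v_add_self, add_zero, add_add_add_comm, v_add_self, add_zero]
  have hginj : Function.Injective (fun a => g a + g 0) := by
    intro a b h
    have h := add_right_cancel h
    have : π (Sum.inr a) = π (Sum.inr b) := by rw [hg, hg, h]
    exact Sum.inr_injective (π.injective this)
  have hgbij := Finite.injective_iff_bijective.mp hginj
  have key : ∀ s, τ (g (τ s) + g 0) = f s + f 0 := by
    intro s
    have hm : permAct π (quad (Sum.inl s) (Sum.inl 0) (Sum.inr (τ s)) (Sum.inr 0)) ∈ Scode τ := by
      rw [← hπ]; exact ⟨_, exists_word τ s, rfl⟩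
    rw [permAct_quad, hf, hf, hg, hg, mem_Scode] at hm
    have := hm.2.2
    simpa only [quad, lf_add, rt_add, lf_inl, lf_inr, rt_inl, rt_inr, syn_add,
      syn_single, syn_zero, add_zero, zero_add] using this
  refine ⟨Equiv.ofBijective _ hgbij, hg_add, ?_⟩
  intro a b
  change τ (g (τ (a + b)) + g 0) = τ (g (τ a) + g 0) + τ (g (τ b) + g 0)
  rw [key, key, key, hf_add]

theorem exists_inl_of {r : ℕ} {π : Equiv.Perm (Pt r)} {s : Bool}
    (h : ∀ a, ∃ b, π (side s a) = Sum.inl b) (p : V r) : ∃ a, π (side s a) = Sum.inl p := by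
  choose f hf using h
  have inj : Function.Injective f := by
    intro a b hab
    have : π (side s a) = π (side s b) := by rw [hf, hf, hab]
    have := π.injective this
    cases s <;> simpa [side] using this
  obtain ⟨a, ha⟩ := (Finite.injective_iff_surjective.mp inj) p
  exact ⟨a, by rw [hf, ha]⟩

theorem exists_inr_of {r : ℕ} {π : Equiv.Perm (Pt r)} {s : Bool}
    (h : ∀ a, ∃ b, π (side s a) = Sum.inr b) (p : V r) : ∃ a, π (side s a) = Sum.inr p := by
  choose f hf using h
  have inj : Function.Injective f := by
    intro a b hab
    have : π (side s a) = π (side s b) := by rw [hf, hf, hab]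
    have := π.injective this
    cases s <;> simpa [side] using this
  obtain ⟨a, ha⟩ := (Finite.injective_iff_surjective.mp inj) p
  exact ⟨a, by rw [hf, ha]⟩

theorem side_inj {r : ℕ} {s t : Bool} {a b : V r} (h : side s a = side t b) : s = t := by
  cases s <;> cases t <;> simp_all [side]

theorem exists_side {r : ℕ} (p : Pt r) : ∃ s a, p = side s a := by
  rcases p with a | a
  · exact ⟨true, a, rfl⟩
  · exact ⟨false, a, rfl⟩

theorem swp_of_coord {r : ℕ} {τ : Equiv.Perm (V r)} (h0 : τ 0 = 0)
    (hc : CoordTransitive (Scode τ)) : Swp τ := by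
  obtain ⟨π, hπ, hp⟩ := hc (Sum.inl 0) (Sum.inr 0)
  by_cases hall : ∀ a, ∃ b, π (side true a) = Sum.inr b
  · -- exchange
    have hr : ∀ a, ∃ b, π (side false a) = Sum.inl b := by
      intro a
      rcases h : π (side false a) with b | b
      · exact ⟨b, rfl⟩
      · obtain ⟨a', ha'⟩ := exists_inr_of hall b
        have := side_inj (π.injective (ha'.trans h.symm))
        simp at this
    choose f hf using hall
    choose g hg using hr
    exact swp_of_exchange h0 hπ f g hf hg
  · push Not at hall
    obtain ⟨l, hl⟩ := hall
    obtain ⟨p, hlp⟩ : ∃ p, π (side true l) = Sum.inl p := by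
      rcases h : π (side true l) with b | b
      · exact ⟨b, rfl⟩
      · exact absurd h (hl b)
    have mixed : ∀ s : Bool, ∃ c t, π (side s c) = Sum.inr t := by
      intro s
      cases s
      · by_contra hcon
        push Not at hcon
        have hr : ∀ a, ∃ b, π (side false a) = Sum.inl b := by
          intro a
          rcases h : π (side false a) with b | b
          · exact ⟨b, rfl⟩
          · exact absurd h (hcon a b)
        obtain ⟨a', ha'⟩ := exists_inl_of hr p
        have := side_inj (π.injective (ha'.trans hlp.symm))
        simp at this
      · exact ⟨0, 0, hp⟩
    have col : ∀ x : V r, ∃ s a, π (side s a) = Sum.inl x := by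
      intro x
      obtain ⟨s, a, h⟩ := exists_side (π.symm (Sum.inl x))
      exact ⟨s, a, by rw [← h]; simp⟩
    have same : ∀ s a b x y, π (side s a) = Sum.inl x → π (side s b) = Sum.inl y →
        LS τ (x + y) := by
      intro s a b x y hx hy
      obtain ⟨c, t, hc⟩ := mixed s
      exact LS_of_mixed h0 hπ s hx hy hc
    apply swp_of_linear
    apply linear_of_LS
    intro x y
    obtain ⟨s0, a0, e0⟩ := col 0
    obtain ⟨s1, a1, e1⟩ := col x
    obtain ⟨s2, a2, e2⟩ := col y
    by_cases h1 : s1 = s0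
    · subst h1
      left
      simpa using same _ _ _ _ _ e1 e0
    by_cases h2 : s2 = s0
    · subst h2
      right; left
      simpa using same _ _ _ _ _ e2 e0
    have h3 : s1 = s2 := by cases s0 <;> cases s1 <;> cases s2 <;> simp_all
    subst h3
    right; right
    exact same _ _ _ _ _ e1 e2

/-! ### Concatenation -/

theorem split_add {r r' : ℕ} (x y : V (r + r')) :
    splitEquiv r r' (x + y) = splitEquiv r r' x + splitEquiv r r' y := rfl

theorem split_concat {r r' : ℕ} (τ : Equiv.Perm (V r)) (τ' : Equiv.Perm (V r'))
    (x : V (r + r')) : splitEquiv r r' (concatPerm τ τ' x) =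
      (τ (splitEquiv r r' x).1, τ' (splitEquiv r r' x).2) := by
  simp [concatPerm, Prod.map]

theorem swp_concat {r r' : ℕ} {τ : Equiv.Perm (V r)} {τ' : Equiv.Perm (V r')}
    (h : Swp τ) (h' : Swp τ') : Swp (concatPerm τ τ') := by
  obtain ⟨B, hB, hA⟩ := h
  obtain ⟨B', hB', hA'⟩ := h'
  refine ⟨concatPerm B B', ?_, ?_⟩
  · intro a b
    apply (splitEquiv r r').injective
    simp only [split_add, split_concat, Prod.fst_add, Prod.snd_add, hB, hB', Prod.mk_add_mk]
  · intro a b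
    apply (splitEquiv r r').injective
    simp only [split_add, split_concat, Prod.fst_add, Prod.snd_add, hA, hA', Prod.mk_add_mk]

theorem concat_zero {r r' : ℕ} {τ : Equiv.Perm (V r)} {τ' : Equiv.Perm (V r')}
    (h0 : τ 0 = 0) (h0' : τ' 0 = 0) : concatPerm τ τ' 0 = 0 := by
  apply (splitEquiv r r').injective
  rw [split_concat]
  exact Prod.ext h0 h0'

/-- Transitivity data. -/
def Trn {r : ℕ} (τ : Equiv.Perm (V r)) : Prop :=
  ∀ a, ∃ A A' : Equiv.Perm (V r), (∀ x y, A (x + y) = A x + A y) ∧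
    (∀ x y, A' (x + y) = A' x + A' y) ∧ ∀ s, τ (a + A s) = τ a + A' (τ s)

theorem trn_concat {r r' : ℕ} {τ : Equiv.Perm (V r)} {τ' : Equiv.Perm (V r')}
    (h : Trn τ) (h' : Trn τ') : Trn (concatPerm τ τ') := by
  intro a
  obtain ⟨A, B, hA, hB, h⟩ := h (splitEquiv r r' a).1
  obtain ⟨A', B', hA', hB', h'⟩ := h' (splitEquiv r r' a).2
  refine ⟨concatPerm A A', concatPerm B B', ?_, ?_, ?_⟩
  all_goals
    intros
    apply (splitEquiv r r').injective
    simp only [split_add, split_concat, Prod.fst_add, Prod.snd_add, hA, hA', hB, hB', h, h',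
      Prod.mk_add_mk]

theorem trn_of_induced {r : ℕ} {τ : Equiv.Perm (V r)} (h : InducedByRegularAut τ) : Trn τ := by
  obtain ⟨G, ⟨haff, hreg⟩, T, hT⟩ := h
  intro a
  obtain ⟨g, hg, -⟩ := hreg 0 a
  obtain ⟨u, A, hA⟩ := haff g g.2
  obtain ⟨v, A', hA'⟩ := haff (T g) (T g).2
  have hu : u = a := by rw [← hg]; simp [hA]
  have hv : v = τ a := by
    rw [← hg, hT, hA']; simp
  subst hu
  refine ⟨A.toEquiv, A'.toEquiv, fun x y => map_add A x y, fun x y => map_add A' x y, ?_⟩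
  intro s
  obtain ⟨k, hk, -⟩ := hreg 0 s
  change τ (u + A s) = τ u + A' (τ s)
  rw [← hA, ← hv, ← hA', ← hk]
  have := hT (g * k)
  rw [map_mul] at this
  simp only [Subgroup.coe_mul, Equiv.Perm.mul_apply] at this
  rw [this, hT]

/-- There is an automorphism moving `c` to `c'`. -/
def Mv {ι : Type} (C : Set (ι → ZMod 2)) (c c' : ι → ZMod 2) : Prop :=
  ∃ (x : ι → ZMod 2) (π : Equiv.Perm ι),
    (fun y => x + permAct π y) '' C = C ∧ x + permAct π c = c'

theorem Mv.trans {ι : Type} {C : Set (ι → ZMod 2)} {a b c : ι → ZMod 2}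
    (h : Mv C a b) (h' : Mv C b c) : Mv C a c := by
  obtain ⟨x, π, h1, h2⟩ := h
  obtain ⟨y, ρ, h3, h4⟩ := h'
  have e : ∀ w, (y + permAct ρ x) + permAct (π.trans ρ) w =
      y + permAct ρ (x + permAct π w) := by
    intro w; rw [permAct_add, permAct_trans, add_assoc]
  refine ⟨y + permAct ρ x, π.trans ρ, ?_, by rw [e, h2, h4]⟩
  have : (fun w => (y + permAct ρ x) + permAct (π.trans ρ) w) =
    (fun w => y + permAct ρ w) ∘ (fun w => x + permAct π w) := funext e
  rw [this, Set.image_comp, h1, h3]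

theorem Mv.symm {ι : Type} {C : Set (ι → ZMod 2)} {a b : ι → ZMod 2}
    (h : Mv C a b) : Mv C b a := by
  obtain ⟨x, π, h1, h2⟩ := h
  have e : ∀ w, permAct π.symm x + permAct π.symm (x + permAct π w) = w := by
    intro w
    rw [← permAct_add, v_cancel]
    funext i; simp [permAct]
  refine ⟨permAct π.symm x, π.symm, ?_, by rw [← h2, e]⟩
  nth_rewrite 1 [← h1]
  rw [← Set.image_comp]
  have : (fun y => permAct π.symm x + permAct π.symm y) ∘ (fun y => x + permAct π y) = id :=
    funext e
  rw [this, Set.image_id]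

theorem mv_zero {r : ℕ} {τ : Equiv.Perm (V r)} (h : Trn τ)
    {c : Pt r → ZMod 2} (hc : c ∈ Scode τ) : Mv (Scode τ) 0 c := by
  rw [mem_Scode] at hc
  obtain ⟨h1, h2, h3⟩ := hc
  obtain ⟨A, A', hA, hA', hs⟩ := h (syn (lf c))
  refine ⟨c, Equiv.sumCongr A A', image_eq_of_mapsTo ?_, by rw [permAct_zero, add_zero]⟩
  intro z hz
  rw [mem_Scode] at hz ⊢
  obtain ⟨k1, k2, k3⟩ := hz
  have e1 : lf (permAct (Equiv.sumCongr A A') z) = fun b => lf z (A.symm b) := rfl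
  have e2 : rt (permAct (Equiv.sumCongr A A') z) = fun b => rt z (A'.symm b) := rfl
  rw [lf_add, rt_add, e1, e2, par_add, par_add, syn_add, syn_add, map_par, map_par,
    map_syn _ hA, map_syn _ hA', h1, h2, k1, k2, hs, h3, k3]
  exact ⟨add_zero _, add_zero _, rfl⟩

theorem hdist_one_exists {ι : Type} [Fintype ι] [DecidableEq ι] {y c : ι → ZMod 2}
    (h : hammingDist y c = 1) : ∃ i, y = c + Pi.single i 1 := by
  unfold hammingDist at h
  obtain ⟨i, hi⟩ := Finset.card_eq_one.mp h
  refine ⟨i, ?_⟩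
  funext j
  have hj := Finset.ext_iff.mp hi j
  simp only [Finset.mem_filter, Finset.mem_univ, true_and, Finset.mem_singleton] at hj
  by_cases hij : j = i
  · subst hij
    have hne := hj.mpr rfl
    simp only [Pi.add_apply, Pi.single_eq_same]
    revert hne
    generalize y j = u
    generalize c j = v
    revert u v
    decide
  · have : y j = c j := by
      by_contra hne; exact hij (hj.mp hne)
    simp [Pi.single_apply, hij, this]

theorem neighbor_of {r : ℕ} {τ : Equiv.Perm (V r)}
    (h : Trn τ) (hcoord : CoordTransitive (Scode τ)) : NeighborTransitive (Scode τ) := by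
  refine ⟨fun c hc c' hc' => (mv_zero h hc).symm.trans (mv_zero h hc'), ?_⟩
  have key : ∀ y ∈ codeNbrs (Scode τ), ∃ i, Mv (Scode τ) (Pi.single i 1) y := by
    rintro y ⟨-, c, hc, hd⟩
    obtain ⟨i, rfl⟩ := hdist_one_exists hd
    obtain ⟨x, π, h1, h2⟩ := mv_zero h hc
    rw [permAct_zero, add_zero] at h2
    subst h2
    refine ⟨π.symm i, x, π, h1, ?_⟩
    rw [permAct_single, Equiv.apply_symm_apply]
  intro y hy y' hy'
  obtain ⟨i, hi⟩ := key y hy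
  obtain ⟨j, hj⟩ := key y' hy'
  obtain ⟨π, hπ, hij⟩ := hcoord i j
  have hm : Mv (Scode τ) (Pi.single i 1) (Pi.single j 1) :=
    ⟨0, π, by simpa using hπ, by rw [permAct_single, hij, zero_add]⟩
  exact (hi.symm.trans hm).trans hj

/-- if `S_τ` and `S_{τ'}` are coordinate transitive codes, then so is
`S_{τ|τ'}`; if moreover `τ`, `τ'` are induced by automorphisms of regular subgroups of
`GA(r,2)` and `GA(r',2)`, then `S_{τ|τ'}` is neighbor transitive. -/
theorem Scode_concat_transitivity {r r' : ℕ}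
    (τ : Equiv.Perm (V r)) (τ' : Equiv.Perm (V r'))
    (h0 : τ 0 = 0) (h0' : τ' 0 = 0)
    (hc : CoordTransitive (Scode τ)) (hc' : CoordTransitive (Scode τ')) :
    CoordTransitive (Scode (concatPerm τ τ')) ∧
    (InducedByRegularAut τ → InducedByRegularAut τ' →
      NeighborTransitive (Scode (concatPerm τ τ'))) := by
  have h1 : CoordTransitive (Scode (concatPerm τ τ')) :=
    coord_of_swp _ (swp_concat (swp_of_coord h0 hc) (swp_of_coord h0' hc'))
  exact ⟨h1, fun h h' => neighbor_of (trn_concat (trn_of_induced h) (trn_of_induced h')) h1⟩
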